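/- Let λ : ℝ → ℝ satisfy λ(t) = 0 for t < 0 and be continuous with λ(t) > 0 on [0, T]; let λ₀ > 0, ν > 0, let θ₁, θ₂, θ₃ ∈ ℝ² be non-collinear, and let Θ ⊂ ℝ² be a bounded set whose closure Θ̄ satisfies ‖θ − θⱼ‖ ≥ ε > 0 and 0 < τⱼ(θ) < T for all θ ∈ Θ̄ and j = 1, 2, 3, where τⱼ(θ) = ‖θⱼ − θ‖/ν. Define λ_{j,n}(θ, t) = nλ(t − τⱼ(θ))·1_{t ≥ τⱼ(θ)} + nλ₀. Then for every compact K ⊂ Θ there exists κ > 0 such that for all θ₀ ∈ K, all n ≥ 1 and all u ∈ ℝ² with θ₀ + u/n ∈ Θ: Σ_{j=1}^{3} ∫₀ᵀ ( √(λ_{j,n}(θ₀ + u/n, t)) − √(λ_{j,n}(θ₀, t)) )² dt ≥ 2κ‖u‖. -/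

import Mathlib

open MeasureTheory Set

/-- The normalized intensity of a signal arriving at time `a`, on top of constant noise. -/
noncomputable def delayedIntensity (lam : ℝ → ℝ) (lam0 a t : ℝ) : ℝ :=
  (if a ≤ t then lam (t - a) else 0) + lam0

/-- A vector difference is controlled by the differences of squared distances to points
spanning the whole space affinely. -/
theorem exists_norm_sub_le_mul_sum_abs_sq_sub_sq {ι V : Type*} [Fintype ι] [Nonempty ι]
    [NormedAddCommGroup V] [InnerProductSpace ℝ V] [FiniteDimensional ℝ V]
    (p : ι → V) (hp : vectorSpan ℝ (range p) = ⊤) :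
    ∃ C > (0 : ℝ), ∀ x y : V,
      ‖x - y‖ ≤ C * ∑ j, |‖p j - x‖ ^ 2 - ‖p j - y‖ ^ 2| := by
  obtain ⟨i⟩ := ‹Nonempty ι›
  let L : V →ₗ[ℝ] (ι → ℝ) := LinearMap.pi fun j => (innerₛₗ ℝ (p j - p i))
  have hL : L.ker = ⊥ := by
    rw [LinearMap.ker_eq_bot']
    intro v hv
    have hv' : v ∈ (vectorSpan ℝ (range p))ᗮ := by
      rw [vectorSpan_range_eq_span_range_vsub_right ℝ p i, Submodule.mem_orthogonal]
      intro w hw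
      induction hw using Submodule.span_induction with
      | mem w hw =>
        obtain ⟨j, rfl⟩ := hw
        exact congrFun hv j
      | zero => simp
      | add a b _ _ ha hb => rw [inner_add_left, ha, hb, add_zero]
      | smul r a _ ha => rw [real_inner_smul_left, ha, mul_zero]
    simpa [hp] using hv'
  obtain ⟨C, hC, hLip⟩ := L.exists_antilipschitzWith hL
  refine ⟨C, NNReal.coe_pos.mpr hC, fun x y => ?_⟩
  have hdist := hLip.le_mul_dist x y
  rw [dist_eq_norm, dist_eq_norm, ← map_sub] at hdist
  refine hdist.trans (mul_le_mul_of_nonneg_left ?_ C.2)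
  have hle : ∀ j, |‖p j - x‖ ^ 2 - ‖p j - y‖ ^ 2| ≤
      ∑ j, |‖p j - x‖ ^ 2 - ‖p j - y‖ ^ 2| := fun j =>
    Finset.single_le_sum (f := fun j => |‖p j - x‖ ^ 2 - ‖p j - y‖ ^ 2|)
      (fun _ _ => abs_nonneg _) (Finset.mem_univ j)
  refine (pi_norm_le_iff_of_nonneg (Finset.sum_nonneg fun _ _ => abs_nonneg _)).mpr fun j => ?_
  have hpolar : 2 * L (x - y) j =
      (‖p i - x‖ ^ 2 - ‖p i - y‖ ^ 2) - (‖p j - x‖ ^ 2 - ‖p j - y‖ ^ 2) := by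
    change 2 * inner ℝ (p j - p i) (x - y) = _
    simp only [norm_sub_sq_real, inner_sub_left, inner_sub_right]
    ring
  have htri := abs_sub (‖p i - x‖ ^ 2 - ‖p i - y‖ ^ 2) (‖p j - x‖ ^ 2 - ‖p j - y‖ ^ 2)
  rw [← hpolar, abs_mul, abs_two] at htri
  rw [Real.norm_eq_abs]
  linarith [hle i, hle j]

/-- On a bounded set, the distances to affinely spanning points form a bi-Lipschitz chart
(lower bound). -/
theorem exists_norm_sub_le_mul_sum_abs_norm_sub_norm {ι V : Type*} [Fintype ι] [Nonempty ι]
    [NormedAddCommGroup V] [InnerProductSpace ℝ V] [FiniteDimensional ℝ V]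
    (p : ι → V) (hp : vectorSpan ℝ (range p) = ⊤) {s : Set V} (hs : Bornology.IsBounded s) :
    ∃ C > (0 : ℝ), ∀ x ∈ s, ∀ y ∈ s,
      ‖x - y‖ ≤ C * ∑ j, |‖p j - x‖ - ‖p j - y‖| := by
  obtain ⟨C, hC, hbound⟩ := exists_norm_sub_le_mul_sum_abs_sq_sub_sq p hp
  obtain ⟨R, hR, hsR⟩ := (hs.union (finite_range p).isBounded).exists_pos_norm_le
  refine ⟨C * (4 * R), by positivity, fun x hx y hy => (hbound x y).trans ?_⟩
  rw [mul_assoc]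
  refine mul_le_mul_of_nonneg_left ?_ hC.le
  rw [Finset.mul_sum]
  refine Finset.sum_le_sum fun j _ => ?_
  have hj := hsR (p j) (Or.inr (mem_range_self j))
  have hjx : ‖p j - x‖ ≤ 2 * R := by linarith [norm_sub_le (p j) x, hsR x (Or.inl hx)]
  have hjy : ‖p j - y‖ ≤ 2 * R := by linarith [norm_sub_le (p j) y, hsR y (Or.inl hy)]
  rw [sq_sub_sq, abs_mul, abs_of_nonneg (by positivity : 0 ≤ ‖p j - x‖ + ‖p j - y‖)]
  exact mul_le_mul_of_nonneg_right (by linarith) (abs_nonneg _)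

section Hellinger

variable {lam : ℝ → ℝ} {T lam0 a b : ℝ}

theorem intervalIntegrable_sq_sqrt_delayedIntensity_sub (hT : 0 ≤ T)
    (hcont : ContinuousOn lam (Icc 0 T)) (ha : 0 ≤ a) (hb : 0 ≤ b) :
    IntervalIntegrable (fun t => (√(delayedIntensity lam lam0 a t)
      - √(delayedIntensity lam lam0 b t)) ^ 2) volume 0 T := by
  let g : ℝ → ℝ := IccExtend hT ((Icc 0 T).domRestrict lam)
  have hg : Continuous g := hcont.domRestrict.Icc_extend'
  have heq : ∀ c, 0 ≤ c → ∀ t ∈ Icc 0 T,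
      delayedIntensity lam lam0 c t = delayedIntensity g lam0 c t := by
    intro c hc t ht
    unfold delayedIntensity
    split_ifs with h
    · have hmem : t - c ∈ Icc 0 T := ⟨by linarith, by linarith [ht.2]⟩
      simp only [g, IccExtend_of_mem hT _ hmem, domRestrict_apply]
    · rfl
  have hmeas : ∀ c, Measurable (delayedIntensity g lam0 c) := fun c =>
    (Measurable.ite measurableSet_Ici (hg.measurable.comp (measurable_id.sub_const c))
      measurable_const).add_const lam0
  obtain ⟨M, hM⟩ := isCompact_Icc.exists_bound_of_continuousOn hcont
  have hM0 : 0 ≤ M := (norm_nonneg _).trans (hM 0 ⟨le_rfl, hT⟩)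
  have hgM : ∀ t, g t ≤ M := fun t => (le_abs_self _).trans (hM _ (projIcc 0 T hT t).2)
  have hle : ∀ c t, √(delayedIntensity g lam0 c t) ≤ √(M + lam0) := by
    intro c t
    refine Real.sqrt_le_sqrt ?_
    unfold delayedIntensity
    split_ifs
    · linarith [hgM (t - c)]
    · linarith
  rw [intervalIntegrable_iff_integrableOn_Icc_of_le hT]
  refine IntegrableOn.congr_fun (f := fun t => (√(delayedIntensity g lam0 a t)
      - √(delayedIntensity g lam0 b t)) ^ 2) ?_ (fun t ht => ?_) measurableSet_Icc
  · refine Measure.integrableOn_of_bounded (M := √(M + lam0) ^ 2) (by simp)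
      (((hmeas a).sqrt.sub (hmeas b).sqrt).pow_const 2).aestronglyMeasurable
      (Filter.Eventually.of_forall fun t => ?_)
    rw [Real.norm_eq_abs, abs_of_nonneg (sq_nonneg _), sq_le_sq, abs_of_nonneg (Real.sqrt_nonneg _)]
    exact abs_le.mpr ⟨by linarith [hle b t, Real.sqrt_nonneg (delayedIntensity g lam0 a t)],
      by linarith [hle a t, Real.sqrt_nonneg (delayedIntensity g lam0 b t)]⟩
  · simp only [heq a ha t ht, heq b hb t ht]

theorem mul_abs_sub_le_integral_sq_sqrt_delayedIntensity_sub (hT : 0 ≤ T)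
    (hcont : ContinuousOn lam (Icc 0 T)) {m : ℝ} (hm : 0 ≤ m) (hlam : ∀ t ∈ Icc 0 T, m ≤ lam t)
    (ha : a ∈ Icc 0 T) (hb : b ∈ Icc 0 T) :
    (√(m + lam0) - √lam0) ^ 2 * |a - b| ≤
      ∫ t in (0 : ℝ)..T, (√(delayedIntensity lam lam0 a t)
        - √(delayedIntensity lam lam0 b t)) ^ 2 := by
  wlog hab : a ≤ b generalizing a b
  · rw [abs_sub_comm]
    simp_rw [sub_sq_comm (√(delayedIntensity lam lam0 a _))]
    exact this hb ha (le_of_not_ge hab)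
  have hint := intervalIntegrable_sq_sqrt_delayedIntensity_sub (lam0 := lam0) hT hcont ha.1 hb.1
  have hsub : uIcc a b ⊆ uIcc 0 T := by
    rw [uIcc_of_le hab, uIcc_of_le hT]
    exact Icc_subset_Icc ha.1 hb.2
  calc (√(m + lam0) - √lam0) ^ 2 * |a - b|
      = ∫ _ in a..b, (√(m + lam0) - √lam0) ^ 2 := by
        rw [intervalIntegral.integral_const, abs_sub_comm, abs_of_nonneg (sub_nonneg.mpr hab),
          smul_eq_mul, mul_comm]
    _ ≤ ∫ t in a..b, (√(delayedIntensity lam lam0 a t)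
          - √(delayedIntensity lam lam0 b t)) ^ 2 := by
        refine intervalIntegral.integral_mono_on_of_le_Ioo hab intervalIntegrable_const
          (hint.mono_set hsub) fun t ht => ?_
        have hmt : m ≤ lam (t - a) := hlam _ ⟨by linarith [ht.1], by linarith [ht.2, hb.2, ha.1]⟩
        rw [delayedIntensity, delayedIntensity, if_pos ht.1.le, if_neg (not_le.mpr ht.2), zero_add]
        refine pow_le_pow_left₀ (sub_nonneg.mpr (Real.sqrt_le_sqrt (by linarith))) ?_ 2
        exact sub_le_sub_right (Real.sqrt_le_sqrt (by linarith)) _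
    _ ≤ _ := intervalIntegral.integral_mono_interval ha.1 hab hb.2
        (Filter.Eventually.of_forall fun t => sq_nonneg _) hint

end Hellinger


/-- **exponent bound of Lemma 3.** Under conditions I₁–I₃, the Hellinger-type
exponent Σⱼ ∫₀ᵀ (√λ_{j,n}(θ₀ + u/n, t) − √λ_{j,n}(θ₀, t))² dt is bounded below by 2κ‖u‖,
uniformly over θ₀ in a compact K ⊆ Θ, n ≥ 1 and u with θ₀ + u/n ∈ Θ. -/
theorem hellinger_exponent_lower_bound
    (lam : ℝ → ℝ) (T : ℝ) (hT : 0 < T)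
    (hneg : ∀ t < (0 : ℝ), lam t = 0)
    (hcont : ContinuousOn lam (Set.Icc 0 T))
    (hpos : ∀ t ∈ Set.Icc (0 : ℝ) T, 0 < lam t)
    (lam0 : ℝ) (hlam0 : 0 < lam0) (ν : ℝ) (hν : 0 < ν)
    (θ : Fin 3 → EuclideanSpace ℝ (Fin 2)) (hθ : AffineIndependent ℝ θ)
    (τ : Fin 3 → EuclideanSpace ℝ (Fin 2) → ℝ)
    (hτ : ∀ (j : Fin 3) (ϑ : EuclideanSpace ℝ (Fin 2)), τ j ϑ = ‖θ j - ϑ‖ / ν)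
    (Θ : Set (EuclideanSpace ℝ (Fin 2))) (hΘbdd : Bornology.IsBounded Θ)
    (ε : ℝ) (hε : 0 < ε)
    (hsep : ∀ ϑ ∈ closure Θ, ∀ j : Fin 3, ε ≤ ‖ϑ - θ j‖)
    (hτΘ : ∀ ϑ ∈ closure Θ, ∀ j : Fin 3, 0 < τ j ϑ ∧ τ j ϑ < T)
    (lamn : Fin 3 → ℕ → EuclideanSpace ℝ (Fin 2) → ℝ → ℝ)
    (hlamn : ∀ (j : Fin 3) (n : ℕ) (ϑ : EuclideanSpace ℝ (Fin 2)) (t : ℝ),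
      lamn j n ϑ t = n * (if τ j ϑ ≤ t then lam (t - τ j ϑ) else 0) + n * lam0)
    (K : Set (EuclideanSpace ℝ (Fin 2))) (hK : IsCompact K) (hKΘ : K ⊆ Θ) :
    ∃ κ > (0 : ℝ), ∀ θ0 ∈ K, ∀ n : ℕ, 1 ≤ n →
      ∀ u : EuclideanSpace ℝ (Fin 2), θ0 + (n : ℝ)⁻¹ • u ∈ Θ →
        2 * κ * ‖u‖ ≤ ∑ j : Fin 3, ∫ t in (0 : ℝ)..T,
          (Real.sqrt (lamn j n (θ0 + (n : ℝ)⁻¹ • u) t)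
            - Real.sqrt (lamn j n θ0 t)) ^ 2 := by
  have hspan : vectorSpan ℝ (range θ) = ⊤ :=
    hθ.vectorSpan_eq_top_of_card_eq_finrank_add_one (by simp)
  obtain ⟨C, hC, hdist⟩ := exists_norm_sub_le_mul_sum_abs_norm_sub_norm θ hspan hΘbdd
  obtain ⟨t0, ht0, hmin⟩ :=
    isCompact_Icc.exists_isMinOn (nonempty_Icc.mpr hT.le) hcont
  have hm := hpos t0 ht0
  set c : ℝ := (√(lam t0 + lam0) - √lam0) ^ 2 with hc_def
  have hc : 0 < c :=
    pow_pos (sub_pos.mpr (Real.sqrt_lt_sqrt hlam0.le (by linarith))) 2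
  refine ⟨c / (2 * C * ν), by positivity, fun θ0 hθ0 n hn u hu => ?_⟩
  have hn0 : (0 : ℝ) < n := by exact_mod_cast hn
  set θ1 := θ0 + (n : ℝ)⁻¹ • u with hθ1
  have hτmem : ∀ j, ∀ ϑ ∈ Θ, τ j ϑ ∈ Icc 0 T := fun j ϑ hϑ =>
    ⟨(hτΘ ϑ (subset_closure hϑ) j).1.le, (hτΘ ϑ (subset_closure hϑ) j).2.le⟩
  have hsensor : ∀ j, n * (c * |τ j θ1 - τ j θ0|) ≤ ∫ t in (0 : ℝ)..T,
      (√(lamn j n θ1 t) - √(lamn j n θ0 t)) ^ 2 := by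
    intro j
    have hscale : ∀ t, (√(lamn j n θ1 t) - √(lamn j n θ0 t)) ^ 2 =
        n * (√(delayedIntensity lam lam0 (τ j θ1) t)
          - √(delayedIntensity lam lam0 (τ j θ0) t)) ^ 2 := by
      intro t
      rw [hlamn, hlamn, ← mul_add, ← mul_add, Real.sqrt_mul hn0.le, Real.sqrt_mul hn0.le,
        ← mul_sub, mul_pow, Real.sq_sqrt hn0.le]
      rfl
    simp_rw [hscale]
    rw [intervalIntegral.integral_const_mul]
    exact mul_le_mul_of_nonneg_left (mul_abs_sub_le_integral_sq_sqrt_delayedIntensity_sub hT.le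
      hcont hm.le (fun t ht => hmin ht) (hτmem j θ1 hu) (hτmem j θ0 (hKΘ hθ0))) hn0.le
  refine le_trans ?_ (Finset.sum_le_sum fun j _ => hsensor j)
  have hd := hdist θ1 hu θ0 (hKΘ hθ0)
  have hu_norm : ‖θ1 - θ0‖ = ‖u‖ / n := by
    rw [hθ1, add_sub_cancel_left, norm_smul, norm_inv, Real.norm_natCast, inv_mul_eq_div]
  have hτabs : ∀ j, |τ j θ1 - τ j θ0| = |‖θ j - θ1‖ - ‖θ j - θ0‖| / ν := fun j => by
    rw [hτ, hτ, ← sub_div, abs_div, abs_of_pos hν]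
  simp_rw [hτabs]
  rw [← Finset.mul_sum, ← Finset.mul_sum, ← Finset.sum_div]
  rw [hu_norm, div_le_iff₀ hn0] at hd
  calc 2 * (c / (2 * C * ν)) * ‖u‖
      ≤ 2 * (c / (2 * C * ν)) * (C * (∑ j, |‖θ j - θ1‖ - ‖θ j - θ0‖|) * n) := by gcongr
    _ = n * (c * ((∑ j, |‖θ j - θ1‖ - ‖θ j - θ0‖|) / ν)) := by field_simp
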